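/- Let p : ℕ → ℝ satisfy: p_j ≥ 0 for all j, p_0 > 0, p_1 = 0, Σ_{j≥0} p_j = 1, Σ_{j≥0} j·p_j = 1, gcd{j ≥ 1 : p_{j+1} > 0} = 1, and Σ_{j≥0} p_j·R^j < ∞ for some R > 1. Set σ² := Σ_{j≥0} j(j−1)·p_j. Suppose (c_n)_{n≥1} is a sequence with c_n ≥ 0, Σ_{n≥1} c_n ≤ 1, such that Φ(y) := Σ_{n≥1} c_n y^n satisfies Φ(y) = Σ_{j≥0} p_j·Φ(y)^j + p_0·(y − 1) for all y ∈ [0,1). Then there is a constant C such that for all n ≥ 1: |c_n − (√(2p_0)/σ)·(2n−3)!!/(2^n·n!)| ≤ C·n^{−2}; consequently c_n = √(p_0/(2πσ²))·n^{−3/2} + O(n^{−2}) as n → ∞. -/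

import Mathlib

/-- `doubleFactOdd m = (2m-1)!! = 1·3·5⋯(2m-1)`, with `(−1)!! = doubleFactOdd 0 = 1`. -/
def doubleFactOdd : ℕ → ℕ
  | 0 => 1
  | (m+1) => (2*m+1) * doubleFactOdd m

section SingularityAnalysis

open Filter Topology

/-- The sum of the complex power series with coefficients `a`. -/
noncomputable def powSum (a : ℕ → ℂ) (z : ℂ) : ℂ := ∑' n, a n * z ^ n

/-- The coefficients of the formal derivative of `∑ a n * z ^ n`. -/
def derivCoeff (a : ℕ → ℂ) (n : ℕ) : ℂ := (n + 1) * a (n + 1)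

/-- `∑ a n * z ^ n` converges absolutely on the open disc of radius `R`. -/
def ConvergesBelow (R : ℝ) (a : ℕ → ℂ) : Prop :=
  ∀ r, 0 < r → r < R → Summable fun n => ‖a n‖ * r ^ n

section PowerSeries

variable {R : ℝ} {a : ℕ → ℂ}

lemma ConvergesBelow.derivCoeff (h : ConvergesBelow R a) : ConvergesBelow R (derivCoeff a) := by
  intro r hr hrR
  obtain ⟨r', hrr', hr'R⟩ := exists_between hrR
  have hr' : 0 < r' := hr.trans hrr'
  have hlim := (tendsto_self_mul_const_pow_of_lt_one (div_nonneg hr.le hr'.le)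
    ((div_lt_one hr').2 hrr')).comp (tendsto_add_atTop_nat 1)
  obtain ⟨M, hM⟩ := hlim.bddAbove_range
  have hs := ((summable_nat_add_iff 1).2 (h r' hr' hr'R)).mul_left (M / r)
  refine hs.of_nonneg_of_le (fun n => by positivity) fun n => ?_
  have hn : ((n : ℝ) + 1) * (r / r') ^ (n + 1) ≤ M := by
    simpa using hM ⟨n, rfl⟩
  have hnorm : ‖_root_.derivCoeff a n‖ = ((n : ℝ) + 1) * ‖a (n + 1)‖ := by
    rw [_root_.derivCoeff, norm_mul]
    congr 1
    exact_mod_cast Complex.norm_natCast (n + 1)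
  calc ‖_root_.derivCoeff a n‖ * r ^ n
      = (((n : ℝ) + 1) * (r / r') ^ (n + 1)) / r * (‖a (n + 1)‖ * r' ^ (n + 1)) := by
        rw [hnorm, div_pow]; field_simp; ring
    _ ≤ M / r * (‖a (n + 1)‖ * r' ^ (n + 1)) := by gcongr

lemma ConvergesBelow.summable_norm (h : ConvergesBelow R a) {z : ℂ} (hz : ‖z‖ < R) :
    Summable fun n => ‖a n * z ^ n‖ := by
  obtain ⟨r, hr, hrR⟩ := exists_between hz
  refine (h r ((norm_nonneg z).trans_lt hr) hrR).of_nonneg_of_le (fun n => norm_nonneg _)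
    fun n => ?_
  rw [norm_mul, norm_pow]
  gcongr

lemma ConvergesBelow.hasSum (h : ConvergesBelow R a) {z : ℂ} (hz : ‖z‖ < R) :
    HasSum (fun n => a n * z ^ n) (powSum a z) :=
  (h.summable_norm hz).of_norm.hasSum

lemma ConvergesBelow.hasDerivAt (h : ConvergesBelow R a) {z : ℂ} (hz : ‖z‖ < R) :
    HasDerivAt (powSum a) (powSum (_root_.derivCoeff a) z) z := by
  obtain ⟨r, hr, hrR⟩ := exists_between hz
  have hu := h r ((norm_nonneg z).trans_lt hr) hrR
  have hd : ∀ n, DifferentiableOn ℂ (fun w : ℂ => a n * w ^ n) (Metric.ball 0 r) := fun n =>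
    (by fun_prop : Differentiable ℂ fun w : ℂ => a n * w ^ n).differentiableOn
  have hle : ∀ n, ∀ w ∈ Metric.ball (0 : ℂ) r, ‖a n * w ^ n‖ ≤ ‖a n‖ * r ^ n := by
    intro n w hw
    rw [norm_mul, norm_pow]
    have := (mem_ball_zero_iff.1 hw).le
    gcongr
  have hzr : z ∈ Metric.ball (0 : ℂ) r := mem_ball_zero_iff.2 hr
  have hdiff := (Complex.differentiableOn_tsum_of_summable_norm hu hd Metric.isOpen_ball
    hle).differentiableAt (Metric.isOpen_ball.mem_nhds hzr)
  have hsum := Complex.hasSum_deriv_of_summable_norm hu hd Metric.isOpen_ball hle hzr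
  have hval : deriv (powSum a) z = powSum (_root_.derivCoeff a) z := by
    refine HasSum.unique hsum ?_
    rw [← hasSum_nat_add_iff' 1]
    have h0 : deriv (fun w : ℂ => a 0 * w ^ 0) z = 0 := by simp
    rw [Finset.sum_range_one, h0, sub_zero]
    refine (h.derivCoeff.hasSum hz).congr_fun fun n => ?_
    simp [_root_.derivCoeff]
    ring
  exact hval ▸ hdiff.hasDerivAt

lemma ConvergesBelow.differentiableOn (h : ConvergesBelow R a) :
    DifferentiableOn ℂ (powSum a) (Metric.ball 0 R) := fun _ hz =>
  (h.hasDerivAt (mem_ball_zero_iff.1 hz)).differentiableAt.differentiableWithinAt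

lemma ConvergesBelow.hasFPowerSeriesOnBall (h : ConvergesBelow R a) (hR : 0 < R) :
    HasFPowerSeriesOnBall (powSum a) (FormalMultilinearSeries.ofScalars ℂ a) 0
      (ENNReal.ofReal R) where
  r_le := by
    refine ENNReal.le_of_forall_nnreal_lt fun r hr => ?_
    refine FormalMultilinearSeries.le_radius_of_summable _ ?_
    have hrR : (r : ℝ) < R := by
      rw [← ENNReal.ofReal_coe_nnreal] at hr
      exact (ENNReal.ofReal_lt_ofReal_iff hR).1 hr
    rcases eq_or_lt_of_le r.2 with h0 | h0
    · have : (r : ℝ) = 0 := h0.symm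
      rw [this]
      refine summable_of_ne_finset_zero (s := {0}) fun n hn => ?_
      simp at hn
      simp [hn]
    · refine (h r h0 hrR).congr fun n => ?_
      simp
  r_pos := ENNReal.ofReal_pos.2 hR
  hasSum := by
    intro y hy
    have hy' : ‖y‖ < R := by
      rw [Metric.eball_ofReal] at hy
      simpa using hy
    simpa [FormalMultilinearSeries.ofScalars_apply_eq, mul_comm] using h.hasSum hy'

end PowerSeries

section CoefficientBound

open Real in
lemma integral_inv_norm_one_sub_circleMap_sq {r : ℝ} (hr0 : 0 ≤ r) (hr1 : r < 1) :
    (2 * π)⁻¹ * ∫ θ in 0..2 * π, (‖1 - circleMap 0 r θ‖ ^ 2)⁻¹ = (1 - r ^ 2)⁻¹ := by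
  have hP := DiffContOnCl.circleAverage_poissonKernel_smul (f := fun _ : ℂ => (1 : ℂ)) (c := 0)
    (R := 1) (w := (r : ℂ)) diffContOnCl_const (by simpa [abs_of_nonneg hr0] using hr1)
  have hnorm : ∀ θ, ‖circleMap 0 1 θ - (r : ℂ)‖ ^ 2 = ‖1 - circleMap 0 r θ‖ ^ 2 := by
    intro θ
    rw [← Complex.normSq_eq_norm_sq, ← Complex.normSq_eq_norm_sq]
    simp only [circleMap_zero, Complex.exp_mul_I, Complex.ofReal_one, one_mul,
      Complex.normSq_apply, Complex.sub_re, Complex.sub_im, Complex.add_re, Complex.add_im,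
      Complex.mul_re, Complex.mul_im, Complex.I_re, Complex.I_im, Complex.ofReal_re,
      Complex.ofReal_im, Complex.one_re, Complex.one_im, Complex.cos_ofReal_re,
      Complex.cos_ofReal_im, Complex.sin_ofReal_re, Complex.sin_ofReal_im]
    linear_combination (1 - r ^ 2) * (Real.sin_sq_add_cos_sq θ)
  have hfun : ∀ θ, (poissonKernel 0 (r : ℂ) • fun _ : ℂ => (1 : ℂ)) (circleMap 0 1 θ) =
      (((1 - r ^ 2) * (‖1 - circleMap 0 r θ‖ ^ 2)⁻¹ : ℝ) : ℂ) := by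
    intro θ
    rw [Pi.smul_apply', poissonKernel_def]
    simp only [sub_zero]
    rw [hnorm]
    simp [div_eq_mul_inv]
  rw [Real.circleAverage] at hP
  simp_rw [hfun] at hP
  rw [intervalIntegral.integral_ofReal, intervalIntegral.integral_const_mul,
    Complex.real_smul] at hP
  norm_cast at hP
  have hr : 1 - r ^ 2 ≠ 0 := by nlinarith
  field_simp
  field_simp at hP
  linarith

lemma norm_coeff_le_of_norm_powSum_le {b : ℕ → ℂ} (hb : ConvergesBelow 1 b) {C : ℝ}
    (hC : ∀ z : ℂ, ‖z‖ < 1 → ‖powSum b z‖ ≤ C * (‖1 - z‖ ^ 2)⁻¹) (n : ℕ) :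
    ‖b n‖ ≤ 8 * C * (n + 1) := by
  have hC0 : 0 ≤ C := by simpa using (norm_nonneg _).trans (hC 0 (by simp))
  have hn : (0 : ℝ) < n + 1 := by positivity
  set r : ℝ := (n + 1) / (n + 2) with hr
  have hr0 : 0 < r := by positivity
  have hr1 : r < 1 := by rw [hr, div_lt_one (by positivity)]; linarith
  lift r to NNReal using hr0.le with r' hr'
  have hball := (hb.differentiableOn.mono
    (Metric.closedBall_subset_ball hr1)).hasFPowerSeriesOnBall (by exact_mod_cast hr0)
  have heq := (hb.hasFPowerSeriesOnBall one_pos).hasFPowerSeriesAt.eq_formalMultilinearSeries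
    hball.hasFPowerSeriesAt
  have hle := norm_cauchyPowerSeries_le (powSum b) 0 r' n
  rw [← heq, FormalMultilinearSeries.ofScalars_norm] at hle
  have hnorm : ∀ θ, ‖circleMap 0 r' θ‖ = r' := by simp
  have hne : ∀ θ, ‖1 - circleMap 0 r' θ‖ ^ 2 ≠ 0 := by
    intro θ h
    have h1 : 1 - circleMap 0 r' θ = 0 := by simpa using h
    have := hnorm θ
    rw [← sub_eq_zero.1 h1, norm_one] at this
    linarith
  have hint : ∫ θ in 0..2 * Real.pi, ‖powSum b (circleMap 0 r' θ)‖ ≤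
      ∫ θ in 0..2 * Real.pi, C * (‖1 - circleMap 0 r' θ‖ ^ 2)⁻¹ := by
    refine intervalIntegral.integral_mono_on Real.two_pi_pos.le ?_ ?_ ?_
    · refine (Continuous.norm ?_).intervalIntegrable _ _
      refine hb.differentiableOn.continuousOn.comp_continuous (continuous_circleMap _ _) ?_
      intro θ
      simpa using hr1
    · refine (Continuous.mul continuous_const (Continuous.inv₀ ?_ hne)).intervalIntegrable _ _
      exact ((continuous_const.sub (continuous_circleMap _ _)).norm).pow 2
    · intro θ _
      exact hC _ (by simpa using hr1)
  rw [intervalIntegral.integral_const_mul] at hint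
  have hI := integral_inv_norm_one_sub_circleMap_sq hr0.le hr1
  have hpow : (r' : ℝ)⁻¹ ^ n ≤ 4 := by
    have h1 : (r' : ℝ)⁻¹ = 1 + 1 / (n + 1) := by rw [hr]; field_simp; ring
    have h2 : (1 : ℝ) + 1 / (n + 1) ≤ Real.exp (1 / (n + 1)) := by
      linarith [Real.add_one_le_exp (1 / ((n : ℝ) + 1))]
    calc (r' : ℝ)⁻¹ ^ n ≤ Real.exp (1 / (n + 1)) ^ n := by rw [h1]; gcongr
      _ = Real.exp (n * (1 / (n + 1))) := (Real.exp_nat_mul _ _).symm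
      _ ≤ Real.exp 1 := by
        refine Real.exp_le_exp.2 ?_
        rw [mul_one_div, div_le_one hn]; linarith
      _ ≤ 4 := by linarith [Real.exp_one_lt_d9]
  have hker : (1 - (r' : ℝ) ^ 2)⁻¹ ≤ 2 * ((n : ℝ) + 1) := by
    have h1 : 1 - (r' : ℝ) = (n + 2 : ℝ)⁻¹ := by rw [hr]; field_simp; ring
    have h2 : (n + 2 : ℝ)⁻¹ ≤ 1 - (r' : ℝ) ^ 2 := by rw [← h1]; nlinarith
    calc (1 - (r' : ℝ) ^ 2)⁻¹ ≤ ((n + 2 : ℝ)⁻¹)⁻¹ := by gcongr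
      _ ≤ 2 * ((n : ℝ) + 1) := by rw [inv_inv]; linarith [(Nat.cast_nonneg n : (0 : ℝ) ≤ n)]
  calc ‖b n‖ ≤ ((2 * Real.pi)⁻¹ * (C * ∫ θ in 0..2 * Real.pi, (‖1 - circleMap 0 r' θ‖ ^ 2)⁻¹))
        * |(r' : ℝ)|⁻¹ ^ n := hle.trans (by gcongr)
    _ = C * (1 - (r' : ℝ) ^ 2)⁻¹ * (r' : ℝ)⁻¹ ^ n := by
      rw [← hI, abs_of_pos hr0]; ring
    _ ≤ C * (2 * (n + 1)) * 4 := by gcongr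
    _ = 8 * C * (n + 1) := by ring

end CoefficientBound

lemma exists_norm_coeff_le_div_sq {e : ℕ → ℂ} (he : ConvergesBelow 1 e) {C : ℝ}
    (hC : ∀ z : ℂ, ‖z‖ < 1 →
      ‖powSum (derivCoeff (derivCoeff (derivCoeff e))) z‖ ≤ C * (‖1 - z‖ ^ 2)⁻¹) :
    ∃ C' : ℝ, ∀ n : ℕ, 1 ≤ n → ‖e n‖ ≤ C' / (n : ℝ) ^ 2 := by
  have hC0 : 0 ≤ C := by simpa using (norm_nonneg _).trans (hC 0 (by simp))
  refine ⟨16 * C + ‖e 1‖ + 4 * ‖e 2‖, fun n hn => ?_⟩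
  rw [le_div_iff₀ (by positivity)]
  rcases n with _ | _ | _ | n
  · omega
  · norm_num
    linarith [norm_nonneg (e 2)]
  · norm_num
    linarith [norm_nonneg (e 1)]
  · have hb := norm_coeff_le_of_norm_powSum_le he.derivCoeff.derivCoeff.derivCoeff hC n
    have hcoeff : ‖derivCoeff (derivCoeff (derivCoeff e)) n‖ =
        ((n : ℝ) + 1) * ((n + 2) * ((n + 3) * ‖e (n + 3)‖)) := by
      have h1 : derivCoeff (derivCoeff (derivCoeff e)) n =
          ((n + 1 : ℕ) : ℂ) * ((n + 2 : ℕ) * ((n + 3 : ℕ) * e (n + 3))) := by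
        simp only [derivCoeff]
        push_cast
        ring
      rw [h1, norm_mul, norm_mul, norm_mul, Complex.norm_natCast, Complex.norm_natCast,
        Complex.norm_natCast]
      push_cast
      ring
    rw [hcoeff] at hb
    have hb' : ((n : ℝ) + 2) * ((n + 3) * ‖e (n + 3)‖) ≤ 8 * C := by
      refine le_of_mul_le_mul_left ?_ (by positivity : (0 : ℝ) < n + 1)
      linarith
    push_cast
    nlinarith [norm_nonneg (e 1), norm_nonneg (e 2), norm_nonneg (e (n + 3)),
      mul_nonneg (n.cast_nonneg (α := ℝ)) (norm_nonneg (e (n + 3))),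
      mul_nonneg (mul_nonneg (n.cast_nonneg (α := ℝ)) (n.cast_nonneg (α := ℝ)))
        (norm_nonneg (e (n + 3)))]

section SquareRoot

/-- The Taylor coefficients of `√(1 - z)` at `0`. -/
noncomputable def sqrtCoeff (n : ℕ) : ℝ :=
  if n = 0 then 1 else -((doubleFactOdd (n - 1) : ℝ) / (2 ^ n * n.factorial))

lemma descPochhammer_smeval_half (n : ℕ) :
    (-1) ^ (n + 1) * (descPochhammer ℤ (n + 1)).smeval (1 / 2 : ℂ) =
      -(doubleFactOdd n : ℂ) / 2 ^ (n + 1) := by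
  induction n with
  | zero => norm_num [doubleFactOdd]
  | succ n ih =>
    rw [descPochhammer_succ_right, Polynomial.smeval_mul, pow_succ, doubleFactOdd]
    have h : (Polynomial.X - ((n + 1 : ℕ) : Polynomial ℤ)).smeval (1 / 2 : ℂ) =
        (1 / 2 : ℂ) - (n + 1) := by
      simp [Polynomial.smeval_sub, Polynomial.smeval_natCast]
    rw [h]
    push_cast
    field_simp
    field_simp at ih
    linear_combination 2 * (2 * (n : ℂ) + 1) * ih

lemma neg_one_pow_mul_choose_half (n : ℕ) :
    (-1) ^ n * Ring.choose (1 / 2 : ℂ) n = (sqrtCoeff n : ℂ) := by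
  rcases n with _ | n
  · simp [sqrtCoeff]
  · have h := descPochhammer_smeval_half n
    rw [Ring.descPochhammer_eq_factorial_smul_choose, nsmul_eq_mul] at h
    have hf : ((n + 1).factorial : ℂ) ≠ 0 := by exact_mod_cast (n + 1).factorial_ne_zero
    simp only [sqrtCoeff, Nat.add_eq_zero_iff, one_ne_zero, and_false, if_false,
      Nat.add_sub_cancel]
    push_cast
    field_simp
    field_simp at h
    linear_combination h

lemma hasSum_sqrtCoeff {z : ℂ} (hz : ‖z‖ < 1) :
    HasSum (fun n => (sqrtCoeff n : ℂ) * z ^ n) ((1 - z) ^ (1 / 2 : ℂ)) := by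
  have h := (Complex.one_add_cpow_hasFPowerSeriesOnBall_zero (a := 1 / 2)).hasSum (y := -z)
    (by rw [← ENNReal.ofReal_one, Metric.eball_ofReal]; simpa using hz)
  rw [zero_add, ← sub_eq_add_neg] at h
  refine h.congr_fun fun n => ?_
  rw [binomialSeries_apply, ← neg_one_pow_mul_choose_half]
  simp [neg_pow z]
  ring

lemma abs_sqrtCoeff_le_one (n : ℕ) : |sqrtCoeff n| ≤ 1 := by
  rcases n with _ | n
  · simp [sqrtCoeff]
  · have h : doubleFactOdd n ≤ 2 ^ (n + 1) * (n + 1).factorial := by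
      induction n with
      | zero => simp [doubleFactOdd]
      | succ n ih =>
        rw [doubleFactOdd, Nat.factorial_succ (n + 1), pow_succ]
        calc (2 * n + 1) * doubleFactOdd n
            ≤ (2 * (n + 1 + 1)) * (2 ^ (n + 1) * (n + 1).factorial) := by gcongr; omega
          _ = _ := by ring
    simp only [sqrtCoeff, Nat.add_eq_zero_iff, one_ne_zero, and_false, if_false,
      Nat.add_sub_cancel, abs_neg]
    rw [abs_of_nonneg (by positivity), div_le_one (by positivity)]
    exact_mod_cast h

lemma convergesBelow_sqrtCoeff : ConvergesBelow 1 fun n => (sqrtCoeff n : ℂ) := by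
  intro r hr hr1
  refine (summable_geometric_of_lt_one hr.le hr1).of_nonneg_of_le (fun n => by positivity)
    fun n => ?_
  have h := abs_sqrtCoeff_le_one n
  rw [Complex.norm_real, Real.norm_eq_abs]
  exact mul_le_of_le_one_left (by positivity) h

lemma powSum_sqrtCoeff_sq {z : ℂ} (hz : ‖z‖ < 1) :
    powSum (fun n => (sqrtCoeff n : ℂ)) z ^ 2 = 1 - z := by
  rw [powSum, (hasSum_sqrtCoeff hz).tsum_eq, one_div, Complex.cpow_ofNat_inv_pow]

lemma powSum_sqrtCoeff_re_nonneg {z : ℂ} (hz : ‖z‖ < 1) :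
    0 ≤ (powSum (fun n => (sqrtCoeff n : ℂ)) z).re := by
  have hne : 1 - z ≠ 0 := by
    rintro h
    rw [← sub_eq_zero.1 h, norm_one] at hz
    exact lt_irrefl _ hz
  rw [powSum, (hasSum_sqrtCoeff hz).tsum_eq, Complex.cpow_def_of_ne_zero hne, Complex.exp_re]
  have him : (Complex.log (1 - z) * (1 / 2)).im = Complex.arg (1 - z) / 2 := by
    have : (1 / 2 : ℂ) = ((1 / 2 : ℝ) : ℂ) := by norm_num
    rw [this, Complex.im_mul_ofReal, Complex.log_im]
    ring
  rw [him]
  refine mul_nonneg (Real.exp_pos _).le (Real.cos_nonneg_of_mem_Icc ⟨?_, ?_⟩)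
  · linarith [Complex.neg_pi_lt_arg (1 - z)]
  · linarith [Complex.arg_le_pi (1 - z)]

end SquareRoot

section DoubleFactorial

open Real

lemma doubleFactOdd_mul (n : ℕ) : doubleFactOdd n * (2 ^ n * n.factorial) = (2 * n).factorial := by
  induction n with
  | zero => simp [doubleFactOdd]
  | succ n ih =>
    rw [show 2 * (n + 1) = 2 * n + 1 + 1 by ring, Nat.factorial_succ (2 * n + 1),
      Nat.factorial_succ (2 * n), ← ih,
      doubleFactOdd, Nat.factorial_succ n, pow_succ]
    ring

lemma doubleFactOdd_sq_mul_wallis (n : ℕ) :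
    ((doubleFactOdd n : ℝ) / (2 ^ n * n.factorial)) ^ 2 * (2 * n + 1) * Wallis.W n = 1 := by
  have hd : (doubleFactOdd n : ℝ) * (2 ^ n * n.factorial) = (2 * n).factorial := by
    exact_mod_cast doubleFactOdd_mul n
  have hf : (n.factorial : ℝ) ≠ 0 := by exact_mod_cast n.factorial_ne_zero
  have hd0 : (doubleFactOdd n : ℝ) ≠ 0 := by
    intro h
    rw [h, zero_mul] at hd
    exact (2 * n).factorial_ne_zero (by exact_mod_cast hd.symm)
  rw [Wallis.W_eq_factorial_ratio, ← hd]
  field_simp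
  ring

lemma abs_doubleFactOdd_mul_sqrt_sub_one_le {n : ℕ} (hn : 1 ≤ n) :
    |(doubleFactOdd n : ℝ) / (2 ^ n * n.factorial) * √(π * n) - 1| ≤ 1 / (2 * n) := by
  have hn' : (1 : ℝ) ≤ n := by exact_mod_cast hn
  set x : ℝ := (doubleFactOdd n : ℝ) / (2 ^ n * n.factorial) with hx
  have hx0 : 0 ≤ x := by positivity
  have hW := doubleFactOdd_sq_mul_wallis n
  rw [← hx] at hW
  have hle := Wallis.W_le n
  have hge := Wallis.le_W n
  rw [div_mul_eq_mul_div, div_le_iff₀ (by positivity)] at hge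
  set t := x * √(π * n) with ht
  have ht0 : 0 ≤ t := by positivity
  have ht2 : t ^ 2 = x ^ 2 * π * n := by
    rw [ht, mul_pow, sq_sqrt (by positivity)]; ring
  have hc : 0 ≤ x ^ 2 * (2 * n + 1) := by positivity
  have h1 := mul_le_mul_of_nonneg_left hle hc
  have h2 := mul_le_mul_of_nonneg_left hge hc
  have hlow : 2 * n ≤ t ^ 2 * (2 * n + 1) := by rw [ht2]; nlinarith
  have hup : t ^ 2 * (2 * n + 1) ^ 2 ≤ 2 * n * (2 * n + 2) := by rw [ht2]; nlinarith
  have ht1 : t ≤ 1 := by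
    by_contra! h
    have : 1 < t ^ 2 := by nlinarith
    nlinarith
  have hlow' : 2 * n ≤ t * (2 * n + 1) := by nlinarith [mul_nonneg ht0 (sub_nonneg.2 ht1)]
  rw [abs_of_nonpos (by linarith), le_div_iff₀ (by positivity)]
  nlinarith

lemma abs_doubleFactOdd_pred_div_sub_le {n : ℕ} (hn : 1 ≤ n) :
    |(doubleFactOdd (n - 1) : ℝ) / (2 ^ n * n.factorial) - 1 / (2 * n * √(π * n))| ≤
      1 / (n : ℝ) ^ 2 := by
  have hn' : (1 : ℝ) ≤ n := by exact_mod_cast hn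
  have ht := abs_doubleFactOdd_mul_sqrt_sub_one_le hn
  have hrec : (doubleFactOdd n : ℝ) = (2 * n - 1) * doubleFactOdd (n - 1) := by
    obtain ⟨m, rfl⟩ := Nat.exists_eq_add_of_le' hn
    rw [doubleFactOdd, Nat.add_sub_cancel]
    push_cast
    ring
  have hs : 1 ≤ √(π * n) := by
    rw [one_le_sqrt]
    nlinarith [pi_gt_three]
  have hpos : (0 : ℝ) < 2 * n - 1 := by linarith
  set t := (doubleFactOdd n : ℝ) / (2 ^ n * n.factorial) * √(π * n) with htdef
  have heq : (doubleFactOdd (n - 1) : ℝ) / (2 ^ n * n.factorial) - 1 / (2 * n * √(π * n)) =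
      ((t - 1) + 1 / (2 * n)) / ((2 * n - 1) * √(π * n)) := by
    have hs0 : √(π * n) ≠ 0 := by positivity
    rw [htdef, hrec]
    field_simp
    ring
  rw [heq, abs_div, abs_of_pos (by positivity : 0 < (2 * (n : ℝ) - 1) * √(π * n))]
  have hnum : |t - 1 + 1 / (2 * n)| ≤ 1 / n := by
    refine (abs_add_le _ _).trans ?_
    rw [abs_of_pos (by positivity : (0 : ℝ) < 1 / (2 * n))]
    calc |t - 1| + 1 / (2 * (n : ℝ)) ≤ 1 / (2 * n) + 1 / (2 * n) := by gcongr
      _ = 1 / n := by field_simp; ring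
  calc |t - 1 + 1 / (2 * n)| / ((2 * n - 1) * √(π * n)) ≤ (1 / n) / (n * 1) := by
        gcongr
        linarith
    _ = 1 / (n : ℝ) ^ 2 := by field_simp

lemma sqrt_div_mul_rpow_eq {q s : ℝ} (hq : 0 < q) (hs : 0 < s) {n : ℕ} (hn : 1 ≤ n) :
    √(q / (2 * π * s)) * (n : ℝ) ^ (-(3 : ℝ) / 2) =
      √(2 * q) / √s * (1 / (2 * n * √(π * n))) := by
  have hn' : (0 : ℝ) < n := by exact_mod_cast hn
  have hpow : (n : ℝ) ^ (-(3 : ℝ) / 2) = 1 / (n * √n) := by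
    rw [show -(3 : ℝ) / 2 = -(1 + 1 / 2) by norm_num, rpow_neg hn'.le, rpow_add hn', rpow_one,
      ← sqrt_eq_rpow, one_div]
  have hquot : √(q / (2 * π * s)) = √(2 * q) / (2 * √s * √π) := by
    rw [sqrt_eq_iff_mul_self_eq (by positivity) (by positivity), ← pow_two, div_pow, mul_pow,
      mul_pow, sq_sqrt (by positivity), sq_sqrt hs.le, sq_sqrt pi_pos.le]
    field_simp
  rw [hpow, hquot, sqrt_mul pi_pos.le]
  field_simp

end DoubleFactorial

section Offspring

lemma eq_one_of_hasSum_mul_eq {q : ℕ → ℝ} {z : ℕ → ℂ} {S : ℝ} (hq : ∀ i, 0 ≤ q i)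
    (hS : HasSum q S) (hz : ∀ i, ‖z i‖ ≤ 1) (hqz : HasSum (fun i => (q i : ℂ) * z i) S) {i : ℕ}
    (hi : 0 < q i) : z i = 1 := by
  have hre : ∀ j, (z j).re ≤ 1 := fun j => (Complex.re_le_norm _).trans (hz j)
  have h0 : HasSum (fun j => q j * (1 - (z j).re)) 0 := by
    have h1 := Complex.hasSum_re hqz
    simp only [Complex.re_ofReal_mul, Complex.ofReal_re] at h1
    simpa [mul_sub] using hS.sub h1
  have hzero := (hasSum_zero_iff_of_nonneg
    fun j => mul_nonneg (hq j) (sub_nonneg.2 (hre j))).1 h0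
  have hi0 : q i * (1 - (z i).re) = 0 := congrFun hzero i
  have hrei : (z i).re = 1 := by
    rcases mul_eq_zero.1 hi0 with h | h
    · exact absurd h hi.ne'
    · linarith
  have hn : Complex.normSq (z i) ≤ 1 := by
    rw [Complex.normSq_eq_norm_sq]
    nlinarith [hz i, norm_nonneg (z i)]
  rw [Complex.normSq_apply, hrei] at hn
  refine Complex.ext hrei ?_
  rw [Complex.one_im]
  nlinarith [mul_self_nonneg (z i).im]

lemma eq_one_of_re_eq_one {w : ℂ} (hw : ‖w‖ ≤ 1) (hre : w.re = 1) : w = 1 := by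
  refine Complex.ext hre ?_
  have hn : Complex.normSq w ≤ 1 := by
    rw [Complex.normSq_eq_norm_sq]
    nlinarith [norm_nonneg w]
  rw [Complex.normSq_apply, hre] at hn
  rw [Complex.one_im]
  nlinarith [mul_self_nonneg w.im]

lemma eq_one_of_geom_sum_eq {w : ℂ} (hw : ‖w‖ ≤ 1) {j : ℕ} (hj : 2 ≤ j)
    (h : ∑ i ∈ Finset.range j, w ^ i = j) : w = 1 := by
  have hle : ∀ i ∈ Finset.range j, (w ^ i).re ≤ 1 := fun i _ =>
    (Complex.re_le_norm _).trans (by rw [norm_pow]; exact pow_le_one₀ (norm_nonneg _) hw)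
  have hsum : ∑ i ∈ Finset.range j, (w ^ i).re = ∑ i ∈ Finset.range j, (1 : ℝ) := by
    rw [← Complex.re_sum, h]
    simp
  have h1 := (Finset.sum_eq_sum_iff_of_le hle).1 hsum 1 (Finset.mem_range.2 (by omega))
  exact eq_one_of_re_eq_one hw (by simpa using h1)

lemma convergesBelow_of_summable {p : ℕ → ℝ} {R : ℝ} (hp : ∀ j, 0 ≤ p j)
    (hRsum : Summable fun j : ℕ => p j * R ^ j) : ConvergesBelow R fun n => (p n : ℂ) := by
  intro r hr hrR
  refine hRsum.of_nonneg_of_le (fun n => by positivity) fun n => ?_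
  rw [Complex.norm_real, Real.norm_of_nonneg (hp n)]
  have := hp n
  gcongr

lemma exists_eq_sub_sq_mul {U : Set ℂ} (hU : IsOpen U) {c : ℂ} (hc : c ∈ U) {G : ℂ → ℂ}
    (hG : DifferentiableOn ℂ G U) (h0 : G c = 0) (h1 : deriv G c = 0) :
    ∃ h : ℂ → ℂ, DifferentiableOn ℂ h U ∧ ∀ w, G w = (w - c) ^ 2 * h w := by
  have hUc := hU.mem_nhds hc
  refine ⟨dslope (dslope G c) c, (Complex.differentiableOn_dslope hUc).2
    ((Complex.differentiableOn_dslope hUc).2 hG), fun w => ?_⟩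
  have e1 := sub_smul_dslope G c w
  have e2 := sub_smul_dslope (dslope G c) c w
  rw [dslope_same, h1, sub_zero, smul_eq_mul] at e2
  rw [h0, sub_zero, smul_eq_mul] at e1
  rw [pow_two, mul_assoc, e2, e1]

variable {p : ℕ → ℝ} {R : ℝ}

lemma hasSum_succ_mul_offspring (hmean : ∑' j : ℕ, (j : ℝ) * p j = 1) :
    HasSum (fun n : ℕ => ((n : ℝ) + 1) * p (n + 1)) 1 := by
  have hs : Summable fun j : ℕ => (j : ℝ) * p j := by
    by_contra h
    rw [tsum_eq_zero_of_not_summable h] at hmean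
    exact zero_ne_one hmean
  have h := (hasSum_nat_add_iff' 1).2 (hmean ▸ hs.hasSum)
  simpa using h

lemma exists_two_le_offspring_pos (hp : ∀ j, 0 ≤ p j) (hp1 : p 1 = 0)
    (hmean : ∑' j : ℕ, (j : ℝ) * p j = 1) : ∃ j, 2 ≤ j ∧ 0 < p j := by
  by_contra! h
  have hz : ∀ j : ℕ, (j : ℝ) * p j = 0 := by
    intro j
    rcases j with _ | _ | j
    · simp
    · simp [hp1]
    · rw [le_antisymm (h (j + 2) (by omega)) (hp _), mul_zero]
  simp [hz] at hmean

lemma eq_one_of_offspring_deriv_eq_one (hp : ∀ j, 0 ≤ p j)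
    (hmean : ∑' j : ℕ, (j : ℝ) * p j = 1)
    (hgcd : ∀ d : ℕ, (∀ j, 1 ≤ j → 0 < p (j + 1) → d ∣ j) → d = 1) (hR : 1 < R)
    (ha : ConvergesBelow R fun n => (p n : ℂ)) {w : ℂ} (hw : ‖w‖ ≤ 1)
    (h : powSum (derivCoeff fun n => (p n : ℂ)) w = 1) : w = 1 := by
  have hsum := ha.derivCoeff.hasSum (hw.trans_lt hR)
  rw [h] at hsum
  refine orderOf_eq_one_iff.1 (hgcd _ fun j _ hpj => orderOf_dvd_of_pow_eq_one ?_)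
  refine eq_one_of_hasSum_mul_eq (z := fun n => w ^ n)
    (fun n => mul_nonneg (by positivity) (hp (n + 1))) (hasSum_succ_mul_offspring hmean)
    (fun n => by rw [norm_pow]; exact pow_le_one₀ (norm_nonneg _) hw) ?_ (i := j)
    (mul_pos (by positivity) hpj)
  simpa [derivCoeff] using hsum

lemma eq_one_of_offspring_fixed (hp : ∀ j, 0 ≤ p j) (hp1 : p 1 = 0) (hpsum : ∑' j, p j = 1)
    (hmean : ∑' j : ℕ, (j : ℝ) * p j = 1) (hR : 1 < R)
    (ha : ConvergesBelow R fun n => (p n : ℂ)) {w : ℂ} (hw : ‖w‖ ≤ 1)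
    (h : powSum (fun n => (p n : ℂ)) w = w) : w = 1 := by
  by_contra hne
  have hne' : w - 1 ≠ 0 := sub_ne_zero.2 hne
  obtain ⟨j, hj, hpj⟩ := exists_two_le_offspring_pos hp hp1 hmean
  have hs : Summable p := by
    by_contra hs
    rw [tsum_eq_zero_of_not_summable hs] at hpsum
    exact zero_ne_one hpsum
  have hs1 : HasSum (fun n => (p n : ℂ)) 1 := by
    simpa only [hpsum, Complex.ofReal_one] using Complex.hasSum_ofReal.2 hs.hasSum
  have hsm : HasSum (fun n : ℕ => (n : ℝ) * p n) 1 := by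
    rw [← hasSum_nat_add_iff' 1]
    simpa using hasSum_succ_mul_offspring hmean
  have hsum := ((ha.hasSum (hw.trans_lt hR)).sub hs1).div_const (w - 1)
  rw [h, div_self hne'] at hsum
  refine hne (eq_one_of_geom_sum_eq hw hj ?_)
  have hj0 : (j : ℂ) ≠ 0 := by exact_mod_cast (by omega : j ≠ 0)
  have hone := eq_one_of_hasSum_mul_eq (z := fun n => (∑ i ∈ Finset.range n, w ^ i) / n)
    (fun n => mul_nonneg n.cast_nonneg (hp n)) hsm ?_ ?_ (i := j)
    (mul_pos (by positivity) hpj)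
  · simpa [div_eq_one_iff_eq hj0] using hone
  · intro n
    rw [norm_div, Complex.norm_natCast]
    refine div_le_one_of_le₀ ((norm_sum_le _ _).trans ?_) n.cast_nonneg
    refine (Finset.sum_le_card_nsmul _ _ 1 fun i _ => ?_).trans (by simp)
    rw [norm_pow]
    exact pow_le_one₀ (norm_nonneg _) hw
  · rw [Complex.ofReal_one]
    refine hsum.congr_fun fun n => ?_
    rcases eq_or_ne n 0 with rfl | hn
    · simp
    · have hn0 : (n : ℂ) ≠ 0 := by exact_mod_cast hn
      rw [geom_sum_eq hne]
      push_cast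
      field_simp

lemma powSum_second_deriv_offspring_one {σ2 : ℝ}
    (hσ2 : σ2 = ∑' j : ℕ, ((j : ℝ) * ((j : ℝ) - 1)) * p j) (hR : 1 < R)
    (ha : ConvergesBelow R fun n => (p n : ℂ)) :
    powSum (derivCoeff (derivCoeff fun n => (p n : ℂ))) 1 = σ2 ∧
      HasSum (fun j : ℕ => ((j : ℝ) * ((j : ℝ) - 1)) * p j) σ2 := by
  have h := ha.derivCoeff.derivCoeff.hasSum (z := 1) (by simpa using hR)
  have hfun : (fun n => derivCoeff (derivCoeff fun n => (p n : ℂ)) n * 1 ^ n) =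
      fun n => ((((n + 2 : ℕ) : ℝ) * (((n + 2 : ℕ) : ℝ) - 1) * p (n + 2) : ℝ) : ℂ) := by
    ext n
    simp only [derivCoeff, one_pow, mul_one]
    push_cast
    ring
  rw [hfun] at h
  have hs := (Complex.summable_ofReal.1 h.summable)
  have hs' := (summable_nat_add_iff (f := fun j : ℕ => ((j : ℝ) * ((j : ℝ) - 1)) * p j) 2).1 hs
  have hσ := hσ2 ▸ hs'.hasSum
  refine ⟨h.unique ?_, hσ⟩
  refine Complex.hasSum_ofReal.2 ?_
  have h2 := (hasSum_nat_add_iff' 2).2 hσ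
  simpa [Finset.sum_range_succ] using h2

lemma offspring_variance_pos (hp : ∀ j, 0 ≤ p j) (hp1 : p 1 = 0)
    (hmean : ∑' j : ℕ, (j : ℝ) * p j = 1) {σ2 : ℝ}
    (hσ : HasSum (fun j : ℕ => ((j : ℝ) * ((j : ℝ) - 1)) * p j) σ2) : 0 < σ2 := by
  obtain ⟨j, hj, hpj⟩ := exists_two_le_offspring_pos hp hp1 hmean
  have hj' : (2 : ℝ) ≤ j := by exact_mod_cast hj
  refine hσ.tsum_eq ▸ hσ.summable.tsum_pos (fun i => ?_) j ?_
  · refine mul_nonneg ?_ (hp i)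
    rcases i with _ | i
    · simp
    · push_cast
      have : (0 : ℝ) ≤ i := i.cast_nonneg
      nlinarith
  · exact mul_pos (mul_pos (by linarith) (by linarith)) hpj

lemma exists_offspring_factorization (hp : ∀ j, 0 ≤ p j) (hp1 : p 1 = 0)
    (hpsum : ∑' j, p j = 1) (hmean : ∑' j : ℕ, (j : ℝ) * p j = 1)
    (hgcd : ∀ d : ℕ, (∀ j, 1 ≤ j → 0 < p (j + 1) → d ∣ j) → d = 1) (hR : 1 < R)
    (ha : ConvergesBelow R fun n => (p n : ℂ)) {σ2 : ℝ} (hσ0 : 0 < σ2)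
    (hσ : powSum (derivCoeff (derivCoeff fun n => (p n : ℂ))) 1 = σ2) :
    ∃ h k : ℂ → ℂ, DifferentiableOn ℂ h (Metric.ball 0 R) ∧
      DifferentiableOn ℂ k (Metric.ball 0 R) ∧
      (∀ w, powSum (fun n => (p n : ℂ)) w - w = (1 - w) ^ 2 * h w) ∧
      (∀ w ∈ Metric.ball (0 : ℂ) R,
        1 - powSum (derivCoeff fun n => (p n : ℂ)) w = (1 - w) * k w) ∧
      (∀ w ∈ Metric.closedBall (0 : ℂ) 1, h w ≠ 0) ∧
      (∀ w ∈ Metric.closedBall (0 : ℂ) 1, k w ≠ 0) ∧ h 1 = σ2 / 2 ∧ k 1 = σ2 := by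
  have h1R : (1 : ℂ) ∈ Metric.ball (0 : ℂ) R := by simpa using hR
  have hsub : Metric.closedBall (0 : ℂ) 1 ⊆ Metric.ball 0 R := Metric.closedBall_subset_ball hR
  have hder : ∀ w ∈ Metric.ball (0 : ℂ) R, HasDerivAt (fun w => powSum (fun n => (p n : ℂ)) w - w)
      (powSum (derivCoeff fun n => (p n : ℂ)) w - 1) w := fun w hw =>
    (ha.hasDerivAt (mem_ball_zero_iff.1 hw)).sub (hasDerivAt_id w)
  have hf1 : powSum (fun n => (p n : ℂ)) 1 = 1 := by
    simp only [powSum, one_pow, mul_one]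
    exact_mod_cast congrArg Complex.ofReal hpsum
  have hf'1 : powSum (derivCoeff fun n => (p n : ℂ)) 1 = 1 := by
    have h := Complex.hasSum_ofReal.2 (hasSum_succ_mul_offspring hmean)
    simpa [powSum, derivCoeff] using h.tsum_eq
  obtain ⟨h, hh, hfac⟩ := exists_eq_sub_sq_mul Metric.isOpen_ball h1R
    (fun w hw => (hder w hw).differentiableAt.differentiableWithinAt) (by rw [hf1, sub_self])
    (by rw [(hder 1 h1R).deriv, hf'1, sub_self])
  have hhd : ∀ w ∈ Metric.ball (0 : ℂ) R, HasDerivAt h (deriv h w) w := fun w hw =>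
    (hh.differentiableAt (Metric.isOpen_ball.mem_nhds hw)).hasDerivAt
  have hh' : DifferentiableOn ℂ (deriv h) (Metric.ball 0 R) := hh.deriv Metric.isOpen_ball
  set k : ℂ → ℂ := fun w => 2 * h w + (w - 1) * deriv h w with hk
  have hkd : DifferentiableOn ℂ k (Metric.ball 0 R) :=
    (hh.const_mul 2).add ((differentiableOn_id.sub_const 1).mul hh')
  have hkfac : ∀ w ∈ Metric.ball (0 : ℂ) R,
      1 - powSum (derivCoeff fun n => (p n : ℂ)) w = (1 - w) * k w := by
    intro w hw
    have e1 : HasDerivAt (fun w => (w - 1) ^ 2 * h w)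
        (2 * (w - 1) * h w + (w - 1) ^ 2 * deriv h w) w := by
      have := (((hasDerivAt_id w).sub_const 1).fun_pow 2).fun_mul (hhd w hw)
      simpa using this
    have e2 := (hder w hw).unique (by simpa only [← hfac] using e1)
    rw [hk]
    linear_combination -e2
  have hk1 : k 1 = σ2 := by
    have e1 : HasDerivAt (fun w => (w - 1) * k w) (k 1) 1 := by
      have hk1 := (hkd.differentiableAt (Metric.isOpen_ball.mem_nhds h1R)).hasDerivAt
      simpa using ((hasDerivAt_id (1 : ℂ)).sub_const 1).fun_mul hk1
    have e2 := (ha.derivCoeff.hasDerivAt (z := 1) (by simpa using hR)).sub_const 1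
    rw [hσ] at e2
    refine e1.unique (e2.congr_of_eventuallyEq ?_)
    filter_upwards [Metric.isOpen_ball.mem_nhds h1R] with w hw
    linear_combination hkfac w hw
  have hh1 : h 1 = σ2 / 2 := by
    have : k 1 = 2 * h 1 := by simp [hk]
    rw [hk1] at this
    rw [this]; ring
  have hσC : (σ2 : ℂ) ≠ 0 := by exact_mod_cast hσ0.ne'
  refine ⟨h, k, hh, hkd, fun w => by rw [hfac w]; ring, hkfac, fun w hw h0 => ?_,
    fun w hw h0 => ?_, hh1, hk1⟩
  · have hw1 : w = 1 := by
      refine eq_one_of_offspring_fixed hp hp1 hpsum hmean hR ha (by simpa using hw) ?_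
      have := hfac w
      rw [h0, mul_zero, sub_eq_zero] at this
      exact this
    rw [hw1, hh1] at h0
    exact hσC (by simpa using h0)
  · have hw1 : w = 1 := by
      refine eq_one_of_offspring_deriv_eq_one hp hmean hgcd hR ha (by simpa using hw) ?_
      have := hkfac w (hsub hw)
      rw [h0, mul_zero, sub_eq_zero] at this
      exact this.symm
    rw [hw1, hk1] at h0
    exact hσC h0

end Offspring

section LocalEstimate

lemma exists_norm_sub_apply_one_le {q : ℂ → ℂ} (hq : ContinuousOn q (Metric.closedBall 0 1))
    (hqd : DifferentiableAt ℂ q 1) :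
    ∃ L : ℝ, 0 ≤ L ∧ ∀ w ∈ Metric.closedBall (0 : ℂ) 1, ‖q w - q 1‖ ≤ L * ‖1 - w‖ := by
  have hc : ContinuousOn (dslope q 1) (Metric.closedBall 0 1) := by
    intro w hw
    rcases eq_or_ne w 1 with rfl | hne
    · exact (continuousAt_dslope_same.2 hqd).continuousWithinAt
    · exact (continuousWithinAt_dslope_of_ne hne).2 (hq w hw)
  obtain ⟨L, hL⟩ := (isCompact_closedBall (0 : ℂ) 1).exists_bound_of_continuousOn hc
  refine ⟨L, (norm_nonneg _).trans (hL 0 (by simp)), fun w hw => ?_⟩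
  rw [← sub_smul_dslope, norm_smul, norm_sub_rev, mul_comm]
  exact mul_le_mul_of_nonneg_right (hL w hw) (norm_nonneg _)

lemma norm_pow_five_sub_le {x y : ℂ} {M : ℝ} (hx : ‖x‖ ≤ M) (hy : ‖y‖ ≤ M) :
    ‖x ^ 5 - y ^ 5‖ ≤ 5 * M ^ 4 * ‖x - y‖ := by
  have hM : 0 ≤ M := (norm_nonneg x).trans hx
  have hterm : ∀ i ∈ Finset.range 5, ‖x ^ i * y ^ (5 - 1 - i)‖ ≤ M ^ 4 := by
    intro i hi
    have hi' : i + (5 - 1 - i) = 4 := by have := Finset.mem_range.1 hi; omega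
    rw [norm_mul, norm_pow, norm_pow]
    calc ‖x‖ ^ i * ‖y‖ ^ (5 - 1 - i) ≤ M ^ i * M ^ (5 - 1 - i) := by gcongr
      _ = M ^ 4 := by rw [← pow_add, hi']
  rw [← geom_sum₂_mul, norm_mul]
  refine mul_le_mul_of_nonneg_right ?_ (norm_nonneg _)
  refine (norm_sum_le _ _).trans ((Finset.sum_le_card_nsmul _ _ _ hterm).trans (by simp))

lemma norm_le_two_mul_re {s : ℂ} (hs : 0 ≤ s.re) (hs2 : 0 < (s ^ 2).re) : ‖s‖ ≤ 2 * s.re := by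
  rw [pow_two, Complex.mul_re] at hs2
  refine abs_le_of_sq_le_sq' ?_ (by positivity) |>.2
  rw [← Complex.normSq_eq_norm_sq, Complex.normSq_apply]
  nlinarith

lemma norm_le_two_mul_norm_add {ρ₀ : ℝ} (hρ₀ : 0 ≤ ρ₀) {s u : ℂ} (hu : 0 ≤ u.re) (hu0 : u ≠ 0)
    (hs : 0 ≤ s.re) (hs2 : 0 < (s ^ 2).re) : ‖s / u‖ ≤ 2 * ‖s / u + ρ₀‖ := by
  have hsum : s / u + ρ₀ = (s + ρ₀ * u) / u := by field_simp
  have hpos : 0 < ‖u‖ := norm_pos_iff.2 hu0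
  rw [hsum, norm_div, norm_div, ← mul_div_assoc]
  gcongr
  have h1 : s.re ≤ (s + ρ₀ * u).re := by
    rw [Complex.add_re, Complex.re_ofReal_mul]
    nlinarith [mul_nonneg hρ₀ hu]
  linarith [norm_le_two_mul_re hs hs2, Complex.re_le_norm (s + ρ₀ * u)]

lemma exists_norm_div_pow_five_sub_le {h q : ℂ → ℂ} {p₀ ρ₀ : ℝ} (hp₀ : 0 < p₀) (hρ₀ : 0 < ρ₀)
    (hh : ContinuousOn h (Metric.closedBall 0 1)) (hhd : DifferentiableAt ℂ h 1)
    (hh0 : ∀ w ∈ Metric.closedBall (0 : ℂ) 1, h w ≠ 0)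
    (hq : ContinuousOn q (Metric.closedBall 0 1)) (hqd : DifferentiableAt ℂ q 1)
    (hh1 : h 1 = p₀ * ρ₀ ^ 2) :
    ∃ C : ℝ, ∀ w s : ℂ, ‖w‖ ≤ 1 → s ≠ 0 → 0 ≤ s.re → 0 < (s ^ 2).re →
      p₀ * s ^ 2 = (1 - w) ^ 2 * h w →
      ‖q w / (1 - w) ^ 5 - q 1 * ρ₀ ^ 5 / s ^ 5‖ ≤ C * (‖s‖ ^ 4)⁻¹ := by
  have hK := isCompact_closedBall (0 : ℂ) 1
  obtain ⟨Lh, hLh0, hLh⟩ := exists_norm_sub_apply_one_le hh hhd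
  obtain ⟨Lq, hLq0, hLq⟩ := exists_norm_sub_apply_one_le hq hqd
  obtain ⟨Mh, hMh⟩ := hK.exists_bound_of_continuousOn hh
  obtain ⟨Mq, hMq⟩ := hK.exists_bound_of_continuousOn hq
  obtain ⟨Mi, hMi⟩ := hK.exists_bound_of_continuousOn (hh.inv₀ hh0)
  have hMq0 : 0 ≤ Mq := (norm_nonneg _).trans (hMq 0 (by simp))
  have hMh0 : 0 < Mh := (norm_pos_iff.2 (hh0 0 (by simp))).trans_le (hMh 0 (by simp))
  have hMi0 : 0 < Mi := (norm_pos_iff.2 (inv_ne_zero (hh0 0 (by simp)))).trans_le (hMi 0 (by simp))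
  set m : ℝ := √(1 / (Mi * p₀)) with hm
  have hm0 : 0 < m := Real.sqrt_pos.2 (by positivity)
  set M : ℝ := √(Mh / p₀) + ρ₀ with hM
  refine ⟨(Lq * ρ₀ ^ 5 + Mq * (5 * M ^ 4 * (2 * Lh / (p₀ * m)))) / m, ?_⟩
  intro w s hw hs0 hsre hs2 heq
  have hwK : w ∈ Metric.closedBall (0 : ℂ) 1 := by simpa using hw
  have hp₀C : (p₀ : ℂ) ≠ 0 := by exact_mod_cast hp₀.ne'
  have hu0 : 1 - w ≠ 0 := by
    intro h0
    rw [h0] at heq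
    simp [hp₀C, hs0] at heq
  have hure : 0 ≤ (1 - w).re := by
    rw [Complex.sub_re, Complex.one_re]
    linarith [Complex.re_le_norm w]
  set u := 1 - w with hu
  set ρ := s / u with hρ
  have hρ2 : ρ ^ 2 = h w / p₀ := by
    rw [hρ, div_pow, div_eq_div_iff (pow_ne_zero 2 hu0) hp₀C]
    linear_combination heq
  have hρn2 : ‖ρ‖ ^ 2 = ‖h w‖ / p₀ := by
    rw [← norm_pow, hρ2, norm_div, Complex.norm_real, Real.norm_of_nonneg hp₀.le]
  have hρM : ‖ρ‖ ≤ M := by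
    have : ‖ρ‖ ≤ √(Mh / p₀) := by
      refine Real.le_sqrt_of_sq_le ?_
      rw [hρn2]
      have := hMh w hwK
      gcongr
    linarith
  have hρ₀M : ‖(ρ₀ : ℂ)‖ ≤ M := by
    rw [Complex.norm_real, Real.norm_of_nonneg hρ₀.le]
    linarith [Real.sqrt_nonneg (Mh / p₀)]
  have hmρ : m ≤ ‖ρ‖ := by
    refine Real.sqrt_le_iff.2 ⟨norm_nonneg _, ?_⟩
    have h1 := hMi w hwK
    rw [Pi.inv_apply, norm_inv] at h1
    have h2 : 0 < ‖h w‖ := norm_pos_iff.2 (hh0 w hwK)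
    rw [hρn2, one_div, mul_inv, div_eq_mul_inv]
    gcongr
    exact inv_le_of_inv_le₀ h2 h1
  have hus : ‖u‖ ≤ ‖s‖ / m := by
    rw [le_div_iff₀ hm0]
    have : ‖s‖ = ‖u‖ * ‖ρ‖ := by rw [← norm_mul, hρ, mul_div_cancel₀ _ hu0]
    rw [this]
    gcongr
  have hdiff : ‖ρ - ρ₀‖ ≤ 2 * Lh / (p₀ * m) * ‖u‖ := by
    have hadd := norm_le_two_mul_norm_add hρ₀.le hure hu0 hsre hs2
    rw [← hρ] at hadd
    have hprod : ‖ρ - ρ₀‖ * ‖ρ + ρ₀‖ ≤ Lh * ‖u‖ / p₀ := by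
      have : (ρ - ρ₀) * (ρ + ρ₀) = (h w - h 1) / p₀ := by
        rw [sub_div, ← hρ2, hh1, mul_div_cancel_left₀ _ hp₀C]; ring
      rw [← norm_mul, this, norm_div, Complex.norm_real, Real.norm_of_nonneg hp₀.le]
      have := hLh w hwK
      gcongr
    have hlow : ‖ρ - ρ₀‖ * (m / 2) ≤ ‖ρ - ρ₀‖ * ‖ρ + ρ₀‖ := by
      gcongr
      linarith
    have := hlow.trans hprod
    rw [le_div_iff₀ hp₀] at this
    rw [div_mul_eq_mul_div, le_div_iff₀ (by positivity)]
    linarith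
  have hsplit : q w / u ^ 5 - q 1 * ρ₀ ^ 5 / s ^ 5 =
      ((q w - q 1) * ρ₀ ^ 5 + q w * (ρ ^ 5 - ρ₀ ^ 5)) / s ^ 5 := by
    rw [hρ]
    field_simp
    ring
  have hspos : 0 < ‖s‖ := norm_pos_iff.2 hs0
  have hnum : ‖(q w - q 1) * ρ₀ ^ 5 + q w * (ρ ^ 5 - ρ₀ ^ 5)‖ ≤
      (Lq * ρ₀ ^ 5 + Mq * (5 * M ^ 4 * (2 * Lh / (p₀ * m)))) * ‖u‖ := by
    refine (norm_add_le _ _).trans ?_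
    rw [norm_mul, norm_mul, norm_pow, Complex.norm_real, Real.norm_of_nonneg hρ₀.le, add_mul]
    have h1 := hLq w hwK
    have h2 := hMq w hwK
    have h3 : ‖ρ ^ 5 - (ρ₀ : ℂ) ^ 5‖ ≤ 5 * M ^ 4 * (2 * Lh / (p₀ * m) * ‖u‖) :=
      (norm_pow_five_sub_le hρM hρ₀M).trans (by gcongr)
    calc ‖q w - q 1‖ * ρ₀ ^ 5 + ‖q w‖ * ‖ρ ^ 5 - (ρ₀ : ℂ) ^ 5‖
        ≤ (Lq * ‖u‖) * ρ₀ ^ 5 + Mq * (5 * M ^ 4 * (2 * Lh / (p₀ * m) * ‖u‖)) := by gcongr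
      _ = _ := by ring
  rw [hsplit, norm_div, norm_pow, div_le_iff₀ (by positivity)]
  refine hnum.trans ?_
  calc (Lq * ρ₀ ^ 5 + Mq * (5 * M ^ 4 * (2 * Lh / (p₀ * m)))) * ‖u‖
      ≤ (Lq * ρ₀ ^ 5 + Mq * (5 * M ^ 4 * (2 * Lh / (p₀ * m)))) * (‖s‖ / m) := by gcongr
    _ = _ := by field_simp

end LocalEstimate

section SingularExpansion

lemma eq_of_hasDerivAt_of_eq_on_disc {F G F' G' : ℂ → ℂ}
    (hF : ∀ z : ℂ, ‖z‖ < 1 → HasDerivAt F (F' z) z)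
    (hG : ∀ z : ℂ, ‖z‖ < 1 → HasDerivAt G (G' z) z) (h : ∀ z : ℂ, ‖z‖ < 1 → F z = G z)
    {z : ℂ} (hz : ‖z‖ < 1) : F' z = G' z := by
  refine (hF z hz).unique ((hG z hz).congr_of_eventuallyEq ?_)
  filter_upwards [Metric.isOpen_ball.mem_nhds (mem_ball_zero_iff.2 hz)] with w hw
  exact h w (mem_ball_zero_iff.1 hw)

lemma third_deriv_of_comp_sub_eq {R p₀ : ℝ} {f f₁ f₂ f₃ φ φ₁ φ₂ φ₃ : ℂ → ℂ}
    (hf : ∀ w : ℂ, ‖w‖ < R → HasDerivAt f (f₁ w) w)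
    (hf₁ : ∀ w : ℂ, ‖w‖ < R → HasDerivAt f₁ (f₂ w) w)
    (hf₂ : ∀ w : ℂ, ‖w‖ < R → HasDerivAt f₂ (f₃ w) w)
    (hφ : ∀ z : ℂ, ‖z‖ < 1 → HasDerivAt φ (φ₁ z) z)
    (hφ₁ : ∀ z : ℂ, ‖z‖ < 1 → HasDerivAt φ₁ (φ₂ z) z)
    (hφ₂ : ∀ z : ℂ, ‖z‖ < 1 → HasDerivAt φ₂ (φ₃ z) z)
    (hφR : ∀ z : ℂ, ‖z‖ < 1 → ‖φ z‖ < R)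
    (heq : ∀ z : ℂ, ‖z‖ < 1 → f (φ z) - φ z = p₀ * (1 - z)) {z : ℂ} (hz : ‖z‖ < 1)
    (hD : 1 - f₁ (φ z) ≠ 0) :
    φ₃ z = p₀ ^ 3 * ((1 - f₁ (φ z)) * f₃ (φ z) + 3 * f₂ (φ z) ^ 2) / (1 - f₁ (φ z)) ^ 5 := by
  have hd : ∀ z : ℂ, ‖z‖ < 1 → HasDerivAt (fun z => 1 - f₁ (φ z)) (-(f₂ (φ z) * φ₁ z)) z :=
    fun z hz => ((hf₁ _ (hφR z hz)).comp z (hφ z hz)).const_sub 1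
  have h₁ : ∀ z : ℂ, ‖z‖ < 1 → φ₁ z * (1 - f₁ (φ z)) = p₀ := by
    intro z hz
    have := eq_of_hasDerivAt_of_eq_on_disc
      (fun z hz => ((hf _ (hφR z hz)).comp z (hφ z hz)).sub (hφ z hz))
      (fun z _ => ((hasDerivAt_id z).const_sub 1).const_mul (p₀ : ℂ)) heq hz
    linear_combination -this
  have h₂ : ∀ z : ℂ, ‖z‖ < 1 → φ₂ z * (1 - f₁ (φ z)) = φ₁ z ^ 2 * f₂ (φ z) := by
    intro z hz
    have := eq_of_hasDerivAt_of_eq_on_disc (fun z hz => (hφ₁ z hz).fun_mul (hd z hz))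
      (fun z _ => hasDerivAt_const z (p₀ : ℂ)) h₁ hz
    linear_combination this
  have h₃ : φ₃ z * (1 - f₁ (φ z)) =
      3 * φ₁ z * φ₂ z * f₂ (φ z) + φ₁ z ^ 3 * f₃ (φ z) := by
    have := eq_of_hasDerivAt_of_eq_on_disc (fun z hz => (hφ₂ z hz).fun_mul (hd z hz))
      (fun z hz => ((hφ₁ z hz).fun_pow 2).fun_mul ((hf₂ _ (hφR z hz)).comp z (hφ z hz))) h₂ hz
    simp only [Function.comp_apply] at this
    linear_combination this
  have e₁ := eq_div_of_mul_eq hD (h₁ z hz)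
  have e₂ := eq_div_of_mul_eq hD (h₂ z hz)
  rw [eq_div_of_mul_eq hD h₃, e₂, e₁]
  field_simp
  ring

lemma third_deriv_of_sq_eq {S S₁ S₂ S₃ : ℂ → ℂ}
    (hS : ∀ z : ℂ, ‖z‖ < 1 → HasDerivAt S (S₁ z) z)
    (hS₁ : ∀ z : ℂ, ‖z‖ < 1 → HasDerivAt S₁ (S₂ z) z)
    (hS₂ : ∀ z : ℂ, ‖z‖ < 1 → HasDerivAt S₂ (S₃ z) z)
    (hsq : ∀ z : ℂ, ‖z‖ < 1 → S z ^ 2 = 1 - z) {z : ℂ} (hz : ‖z‖ < 1) (hz0 : S z ≠ 0) :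
    S₃ z = -3 / (8 * S z ^ 5) := by
  have h₁ : ∀ z : ℂ, ‖z‖ < 1 → S z * S₁ z = -1 / 2 := by
    intro z hz
    have := eq_of_hasDerivAt_of_eq_on_disc (fun z hz => (hS z hz).fun_pow 2)
      (fun z _ => (hasDerivAt_id z).const_sub 1) hsq hz
    linear_combination this / 2
  have h₂ : ∀ z : ℂ, ‖z‖ < 1 → S₁ z * S₁ z + S z * S₂ z = 0 := fun z hz =>
    eq_of_hasDerivAt_of_eq_on_disc (fun z hz => (hS z hz).fun_mul (hS₁ z hz))
      (fun z _ => hasDerivAt_const z (-1 / 2 : ℂ)) h₁ hz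
  have h₃ := eq_of_hasDerivAt_of_eq_on_disc
    (fun z hz => ((hS₁ z hz).fun_mul (hS₁ z hz)).fun_add ((hS z hz).fun_mul (hS₂ z hz)))
    (fun z _ => hasDerivAt_const z (0 : ℂ)) h₂ hz
  have e₁ : S₁ z = -1 / 2 / S z := by
    rw [eq_div_iff hz0, mul_comm]; exact h₁ z hz
  have e₂ : S₂ z = -(S₁ z * S₁ z) / S z := by
    rw [eq_div_iff hz0]; linear_combination h₂ z hz
  have e₃ : S₃ z = -(3 * S₁ z * S₂ z) / S z := by
    rw [eq_div_iff hz0]; linear_combination h₃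
  rw [e₃, e₂, e₁]
  field_simp
  norm_num

lemma norm_powSum_le_one {c : ℕ → ℝ} (hc : ∀ n, 0 ≤ c n) (hcS : Summable c)
    (hcle : ∑' n, c n ≤ 1) {z : ℂ} (hz : ‖z‖ < 1) : ‖powSum (fun n => (c n : ℂ)) z‖ ≤ 1 := by
  refine (tsum_of_norm_bounded hcS.hasSum fun n => ?_).trans hcle
  rw [norm_mul, norm_pow, Complex.norm_real, Real.norm_of_nonneg (hc n)]
  exact mul_le_of_le_one_right (hc n) (pow_le_one₀ (norm_nonneg z) hz.le)

lemma powSum_comp_sub_eq {p c : ℕ → ℝ} {R : ℝ} (hR : 1 < R)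
    (ha : ConvergesBelow R fun n => (p n : ℂ)) (hb : ConvergesBelow 1 fun n => (c n : ℂ))
    (hle : ∀ z : ℂ, ‖z‖ < 1 → ‖powSum (fun n => (c n : ℂ)) z‖ ≤ 1)
    (hΦ : ∀ y ∈ Set.Ico (0 : ℝ) 1,
      (∑' n, c n * y ^ n) = (∑' j, p j * (∑' n, c n * y ^ n) ^ j) + p 0 * (y - 1))
    {z : ℂ} (hz : ‖z‖ < 1) :
    powSum (fun n => (p n : ℂ)) (powSum (fun n => (c n : ℂ)) z) - powSum (fun n => (c n : ℂ)) z =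
      p 0 * (1 - z) := by
  have hφ := hb.differentiableOn
  have hF : AnalyticOnNhd ℂ (fun z => powSum (fun n => (p n : ℂ)) (powSum (fun n => (c n : ℂ)) z) -
      powSum (fun n => (c n : ℂ)) z) (Metric.ball 0 1) := by
    refine DifferentiableOn.analyticOnNhd (DifferentiableOn.sub ?_ hφ) Metric.isOpen_ball
    exact ha.differentiableOn.comp hφ fun z hz => mem_ball_zero_iff.2
      ((hle z (mem_ball_zero_iff.1 hz)).trans_lt hR)
  have hG : AnalyticOnNhd ℂ (fun z : ℂ => (p 0 : ℂ) * (1 - z)) (Metric.ball 0 1) :=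
    DifferentiableOn.analyticOnNhd (by fun_prop) Metric.isOpen_ball
  have hreal : ∀ y ∈ Set.Ico (0 : ℝ) 1,
      powSum (fun n => (p n : ℂ)) (powSum (fun n => (c n : ℂ)) y) -
        powSum (fun n => (c n : ℂ)) y = p 0 * (1 - (y : ℂ)) := by
    intro y hy
    have hcast : powSum (fun n => (c n : ℂ)) y = ((∑' n, c n * y ^ n : ℝ) : ℂ) := by
      simp [powSum, Complex.ofReal_tsum]
    have h := congrArg Complex.ofReal (hΦ y hy)
    rw [Complex.ofReal_add, Complex.ofReal_tsum (fun j => p j * (∑' n, c n * y ^ n) ^ j)] at h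
    rw [hcast, powSum]
    push_cast at h ⊢
    linear_combination -h
  have hlim : Tendsto (fun n : ℕ => (((1 / ((n : ℝ) + 1) / 2 : ℝ)) : ℂ)) atTop (𝓝[≠] 0) := by
    refine tendsto_nhdsWithin_iff.2 ⟨?_, Eventually.of_forall fun n => ?_⟩
    · have := (tendsto_one_div_add_atTop_nhds_zero_nat (𝕜 := ℝ)).div_const 2
      rw [zero_div] at this
      exact_mod_cast (Complex.continuous_ofReal.tendsto 0).comp this
    · exact Complex.ofReal_ne_zero.2 (by positivity)
  refine hF.eqOn_of_preconnected_of_frequently_eq hG (convex_ball 0 1).isPreconnected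
    (Metric.mem_ball_self one_pos) (hlim.frequently (Frequently.of_forall fun n => ?_))
    (mem_ball_zero_iff.2 hz)
  refine hreal _ ⟨by positivity, ?_⟩
  have : 1 / ((n : ℝ) + 1) ≤ 1 := by
    rw [div_le_one (by positivity)]
    linarith [n.cast_nonneg (α := ℝ)]
  linarith

lemma ConvergesBelow.add_const_mul {R : ℝ} {a b : ℕ → ℂ} (ha : ConvergesBelow R a)
    (hb : ConvergesBelow R b) (A : ℂ) : ConvergesBelow R fun n => a n + A * b n := by
  intro r hr hrR
  refine ((ha r hr hrR).add ((hb r hr hrR).mul_left ‖A‖)).of_nonneg_of_le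
    (fun n => by positivity) fun n => ?_
  calc ‖a n + A * b n‖ * r ^ n ≤ (‖a n‖ + ‖A * b n‖) * r ^ n := by gcongr; exact norm_add_le _ _
    _ = ‖a n‖ * r ^ n + ‖A‖ * (‖b n‖ * r ^ n) := by rw [norm_mul]; ring

lemma derivCoeff_add_const_mul (a b : ℕ → ℂ) (A : ℂ) :
    derivCoeff (fun n => a n + A * b n) = fun n => derivCoeff a n + A * derivCoeff b n := by
  ext n
  simp only [derivCoeff]
  ring

lemma powSum_add_const_mul {R : ℝ} {a b : ℕ → ℂ} (ha : ConvergesBelow R a)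
    (hb : ConvergesBelow R b) (A : ℂ) {z : ℂ} (hz : ‖z‖ < R) :
    powSum (fun n => a n + A * b n) z = powSum a z + A * powSum b z := by
  rw [← ((ha.hasSum hz).add ((hb.hasSum hz).mul_left A)).tsum_eq, powSum]
  refine tsum_congr fun n => ?_
  ring

lemma exists_abs_sub_doubleFactOdd_le {p c : ℕ → ℝ}
    (hp : ∀ j, 0 ≤ p j) (hp0 : 0 < p 0) (hp1 : p 1 = 0) (hpsum : ∑' j, p j = 1)
    (hmean : ∑' j : ℕ, (j : ℝ) * p j = 1)
    (hgcd : ∀ d : ℕ, (∀ j, 1 ≤ j → 0 < p (j + 1) → d ∣ j) → d = 1)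
    {R : ℝ} (hR : 1 < R) (ha : ConvergesBelow R fun n => (p n : ℂ)) {σ2 : ℝ} (hσ0 : 0 < σ2)
    (hσ : powSum (derivCoeff (derivCoeff fun n => (p n : ℂ))) 1 = σ2)
    (hc : ∀ n, 0 ≤ c n) (hcS : Summable c) (hcle : ∑' n, c n ≤ 1)
    (hΦ : ∀ y ∈ Set.Ico (0 : ℝ) 1,
      (∑' n, c n * y ^ n) = (∑' j, p j * (∑' n, c n * y ^ n) ^ j) + p 0 * (y - 1)) :
    ∃ C : ℝ, ∀ n : ℕ, 1 ≤ n →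
      |c n - √(2 * p 0) / √σ2 * ((doubleFactOdd (n - 1) : ℝ) / (2 ^ n * n.factorial))| ≤
        C / (n : ℝ) ^ 2 := by
  obtain ⟨h, k, hh, hk, hfac, hkfac, hh0, hk0, hh1, hk1⟩ :=
    exists_offspring_factorization hp hp1 hpsum hmean hgcd hR ha hσ0 hσ
  have hb : ConvergesBelow 1 fun n => (c n : ℂ) :=
    convergesBelow_of_summable hc (by simpa using hcS)
  have hle := fun z hz => norm_powSum_le_one hc hcS hcle (z := z) hz
  have hsub : Metric.closedBall (0 : ℂ) 1 ⊆ Metric.ball 0 R := Metric.closedBall_subset_ball hR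
  have h1R : Metric.ball (0 : ℂ) R ∈ 𝓝 1 := Metric.isOpen_ball.mem_nhds (by simpa using hR)
  set a₂ := derivCoeff (derivCoeff fun n => (p n : ℂ)) with ha₂
  set q : ℂ → ℂ := fun w => p 0 ^ 3 * ((1 - w) * powSum (derivCoeff a₂) w / k w ^ 4 +
    3 * powSum a₂ w ^ 2 / k w ^ 5) with hq
  have hqd : ∀ w ∈ Metric.ball (0 : ℂ) R, k w ≠ 0 → DifferentiableAt ℂ q w := by
    intro w hw hkw
    have d₁ := hk.differentiableAt (Metric.isOpen_ball.mem_nhds hw)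
    have d₂ := (ha.derivCoeff.derivCoeff.hasDerivAt (mem_ball_zero_iff.1 hw)).differentiableAt
    have d₃ := (ha.derivCoeff.derivCoeff.derivCoeff.hasDerivAt
      (mem_ball_zero_iff.1 hw)).differentiableAt
    exact (((((differentiableAt_id.const_sub 1).mul d₃).div (d₁.pow 4) (pow_ne_zero _ hkw)).add
      (((d₂.pow 2).const_mul 3).div (d₁.pow 5) (pow_ne_zero _ hkw))).const_mul _)
  set A : ℝ := √(2 * p 0) / √σ2 with hA
  have hA0 : 0 < A := by positivity
  have hA2 : A ^ 2 = 2 * p 0 / σ2 := by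
    rw [hA, div_pow, Real.sq_sqrt (by positivity), Real.sq_sqrt hσ0.le]
  have hq1 : q 1 * (A⁻¹ : ℝ) ^ 5 = 3 * A / 8 := by
    have hp2 : p 0 = A ^ 2 * σ2 / 2 := by rw [hA2]; field_simp
    have hσne : (σ2 : ℂ) ≠ 0 := Complex.ofReal_ne_zero.2 hσ0.ne'
    have hAne : (A : ℂ) ≠ 0 := Complex.ofReal_ne_zero.2 hA0.ne'
    simp only [hq, hk1, hσ, hp2]
    push_cast
    field_simp
    ring
  obtain ⟨C, hC⟩ := exists_norm_div_pow_five_sub_le (h := h) (q := q) hp0 (inv_pos.2 hA0)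
    (hh.continuousOn.mono hsub) (hh.differentiableAt h1R) hh0
    (fun w hw => (hqd w (hsub hw) (hk0 w hw)).continuousAt.continuousWithinAt)
    (hqd 1 (mem_of_mem_nhds h1R) (hk0 1 (by simp)))
    (by
      rw [hh1]
      norm_cast
      rw [inv_pow, hA2]
      field_simp)
  have hS := convergesBelow_sqrtCoeff
  obtain ⟨C', hC'⟩ := exists_norm_coeff_le_div_sq (hb.add_const_mul hS (A : ℂ)) (C := C) (by
    intro z hz
    set φ := powSum (fun n => (c n : ℂ)) with hφ
    set S := powSum fun n => (sqrtCoeff n : ℂ) with hSdef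
    have hz1 : 0 < (1 - z).re := by
      have := (Complex.abs_re_le_norm z).trans_lt hz
      rw [Complex.sub_re, Complex.one_re]
      linarith [(abs_lt.1 this).2]
    have hne : (1 - z) ≠ 0 := fun h0 => by simp [h0] at hz1
    have hsq : S z ^ 2 = 1 - z := powSum_sqrtCoeff_sq hz
    have hS0 : S z ≠ 0 := fun h0 => hne (by rw [← hsq, h0]; ring)
    have hfun : ∀ z : ℂ, ‖z‖ < 1 → powSum (fun n => (p n : ℂ)) (φ z) - φ z = p 0 * (1 - z) :=
      fun z hz => powSum_comp_sub_eq hR ha hb hle hΦ hz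
    have hs : p 0 * S z ^ 2 = (1 - φ z) ^ 2 * h (φ z) := by rw [hsq, ← hfac, hfun z hz]
    have hu0 : 1 - φ z ≠ 0 := fun h0 => by
      rw [h0] at hs
      simp [hS0, hp0.ne'] at hs
    have hkφ : k (φ z) ≠ 0 := hk0 _ (mem_closedBall_zero_iff.2 (hle z hz))
    have hD := hkfac (φ z) (hsub (mem_closedBall_zero_iff.2 (hle z hz)))
    have h3 := third_deriv_of_comp_sub_eq (fun w hw => ha.hasDerivAt hw)
      (fun w hw => ha.derivCoeff.hasDerivAt hw)
      (fun w hw => ha.derivCoeff.derivCoeff.hasDerivAt hw) (fun z hz => hb.hasDerivAt hz)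
      (fun z hz => hb.derivCoeff.hasDerivAt hz)
      (fun z hz => hb.derivCoeff.derivCoeff.hasDerivAt hz) (fun z hz => (hle z hz).trans_lt hR)
      hfun hz (by rw [hD]; exact mul_ne_zero hu0 hkφ)
    have hS3 := third_deriv_of_sq_eq (fun z hz => hS.hasDerivAt hz)
      (fun z hz => hS.derivCoeff.hasDerivAt hz) (fun z hz => hS.derivCoeff.derivCoeff.hasDerivAt hz)
      (fun z hz => powSum_sqrtCoeff_sq hz) hz hS0
    have hqφ : powSum (derivCoeff (derivCoeff (derivCoeff fun n => (c n : ℂ)))) z =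
        q (φ z) / (1 - φ z) ^ 5 := by
      rw [h3, ← hφ, hD, hq, ha₂]
      field_simp
    have hnorm : ‖S z‖ ^ 4 = ‖1 - z‖ ^ 2 := by rw [← hsq, norm_pow]; ring
    rw [derivCoeff_add_const_mul, derivCoeff_add_const_mul, derivCoeff_add_const_mul,
      powSum_add_const_mul hb.derivCoeff.derivCoeff.derivCoeff
        hS.derivCoeff.derivCoeff.derivCoeff _ hz, hqφ, hS3, ← hSdef, ← hnorm]
    have hgoal := hC (φ z) (S z) (hle z hz) hS0 (powSum_sqrtCoeff_re_nonneg hz)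
      (by rwa [hsq]) hs
    rw [hq1] at hgoal
    convert hgoal using 2
    field_simp
    ring)
  refine ⟨C', fun n hn => ?_⟩
  have hn0 : n ≠ 0 := by omega
  have := hC' n hn
  rw [sqrtCoeff, if_neg hn0] at this
  rw [← Real.norm_eq_abs, ← Complex.norm_real]
  convert this using 2
  push_cast
  ring

end SingularExpansion

end SingularityAnalysis

/-- Asymptotics of the probability that the critical terminal Galton–Watson tree
has exactly `n` leaves:
`c_n = (√(2p_0)/σ)·(2n−3)!!/(2^n·n!) + O(n^{−2}) = √(p_0/(2πσ²))·n^{−3/2} + O(n^{−2})`. -/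
theorem leaf_count_probability_asymptotics (p : ℕ → ℝ) (c : ℕ → ℝ)
    (hp : ∀ j, 0 ≤ p j) (hp0 : 0 < p 0) (hp1 : p 1 = 0)
    (hpsum : ∑' j, p j = 1)
    (hmean : ∑' j : ℕ, (j : ℝ) * p j = 1)
    (hgcd : ∀ d : ℕ, (∀ j, 1 ≤ j → 0 < p (j+1) → d ∣ j) → d = 1)
    (R : ℝ) (hR : 1 < R) (hRsum : Summable (fun j : ℕ => p j * R^j))
    (σ2 : ℝ) (hσ2 : σ2 = ∑' j : ℕ, ((j : ℝ) * ((j : ℝ) - 1)) * p j)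
    (hc0 : c 0 = 0) (hc : ∀ n, 0 ≤ c n) (hcS : Summable c) (hcle : ∑' n, c n ≤ 1)
    (hΦ : ∀ y ∈ Set.Ico (0:ℝ) 1,
      (∑' n, c n * y^n) = (∑' j, p j * (∑' n, c n * y^n)^j) + p 0 * (y - 1)) :
    (∃ C : ℝ, ∀ n : ℕ, 1 ≤ n →
      |c n - Real.sqrt (2 * p 0) / Real.sqrt σ2 *
        (doubleFactOdd (n-1) : ℝ) / (2^n * n.factorial)| ≤ C / (n : ℝ)^2) ∧
    (∃ C : ℝ, ∀ n : ℕ, 1 ≤ n →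
      |c n - Real.sqrt (p 0 / (2 * Real.pi * σ2)) * (n : ℝ)^(-(3:ℝ)/2)| ≤ C / (n : ℝ)^2) := by
  have ha := convergesBelow_of_summable hp hRsum
  obtain ⟨hσ, hσsum⟩ := powSum_second_deriv_offspring_one hσ2 hR ha
  have hσ0 := offspring_variance_pos hp hp1 hmean hσsum
  obtain ⟨C, hC⟩ := exists_abs_sub_doubleFactOdd_le hp hp0 hp1 hpsum hmean hgcd hR ha hσ0 hσ
    hc hcS hcle hΦ
  refine ⟨⟨C, fun n hn => ?_⟩, ⟨C + √(2 * p 0) / √σ2, fun n hn => ?_⟩⟩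
  · rw [mul_div_assoc]
    exact hC n hn
  · have h := abs_doubleFactOdd_pred_div_sub_le hn
    rw [sqrt_div_mul_rpow_eq hp0 hσ0 hn, add_div]
    refine (abs_sub_le _ (√(2 * p 0) / √σ2 * ((doubleFactOdd (n - 1) : ℝ) /
      (2 ^ n * n.factorial))) _).trans (add_le_add (hC n hn) ?_)
    rw [← mul_sub, abs_mul, abs_of_nonneg (by positivity), div_eq_mul_one_div (_ / _) (_ ^ 2)]
    gcongr
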